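/- arXiv:1804.08029 — 6 statements merged into one kernel-verified Lean document; each statement's English description precedes it below -/
import Mathlib

section
/- Let d ≥ 1 be an integer and let t_1 < t_2 < … < t_{d+2} be real numbers. For i ∈ {1, …, d+2} set λ_i := (−1)^i · V_i, where V_i := ∏_{1 ≤ k < ℓ ≤ d+2, k ≠ i, ℓ ≠ i} (t_ℓ − t_k). Then each V_i is strictly positive, the signs of the λ_i strictly alternate, and the λ_i form an affine dependence of the points μ_d(t_1), …, μ_d(t_{d+2}): namely ∑_{i=1}^{d+2} λ_i = 0 and ∑_{i=1}^{d+2} λ_i · μ_d(t_i) = 0 in ℝ^d (equivalently, ∑_{i=1}^{d+2} λ_i · t_i^j = 0 for every j with 0 ≤ j ≤ d). -/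
open Finset

/-- The `d`-th moment curve `t ↦ (t, t², …, t^d)` in `ℝ^d`. -/
noncomputable def moment (d : ℕ) (s : ℝ) : Fin d → ℝ := fun i => s ^ (i.val + 1)

/-- The Vandermonde product over the indices different from `i` is the determinant of the
Vandermonde matrix of the points with the `i`-th one left out. -/
theorem prod_erase_sub_eq_det_vandermonde {R : Type*} [CommRing R] {n : ℕ}
    (t : Fin (n + 1) → R) (i : Fin (n + 1)) :
    ∏ ℓ ∈ Finset.univ.erase i, ∏ k ∈ (Finset.Iio ℓ).erase i, (t ℓ - t k) =
      (Matrix.vandermonde (t ∘ i.succAbove)).det := by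
  have h_univ : Finset.univ.erase i = Finset.univ.map i.succAboveEmb := by
    ext a
    simp [Fin.exists_succAbove_eq_iff]
  have h_Iio (a : Fin n) :
      (Finset.Iio (i.succAbove a)).erase i = (Finset.Iio a).map i.succAboveEmb := by
    ext b
    rcases Fin.eq_self_or_eq_succAbove i b with rfl | ⟨c, rfl⟩
    · simp [Fin.succAbove_ne]
    · simp [Fin.succAbove_ne, Fin.succAbove_lt_succAbove_iff]
  rw [Matrix.det_vandermonde, h_univ, Finset.prod_map]
  simp only [Fin.coe_succAboveEmb, h_Iio, Finset.prod_map, Function.comp_apply]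
  exact Finset.prod_comm' (by simp)

/-- The signed maximal minors of a rectangular Vandermonde matrix form a linear dependence
of its rows. -/
theorem sum_neg_one_pow_mul_pow_mul_det_vandermonde {R : Type*} [CommRing R] {n : ℕ}
    (t : Fin (n + 1) → R) (j : Fin n) :
    ∑ i, (-1) ^ i.val * t i ^ j.val * (Matrix.vandermonde (t ∘ i.succAbove)).det = 0 := by
  let M : Matrix (Fin (n + 1)) (Fin (n + 1)) R :=
    Matrix.of fun i => Fin.cons (t i ^ j.val) fun k : Fin n => t i ^ k.val
  have h_det : M.det = 0 :=
    Matrix.det_zero_of_column_eq (Fin.succ_ne_zero j).symm fun i => by simp [M]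
  rw [Matrix.det_succ_column_zero] at h_det
  exact h_det

/-- For `d+2` points on the moment curve with strictly increasing parameters,
the coefficients `λ_i = (-1)^i · V_i` (with `1`-based index `i = i.val + 1`),
where `V_i` is the Vandermonde product over the indices different from `i`,
are strictly alternating in sign (each `V_i` being positive) and form an
affine dependence: `∑ λ_i = 0` and `∑ λ_i • μ_d(t_i) = 0`, equivalently
`∑ λ_i t_i^j = 0` for all `0 ≤ j ≤ d`. -/
theorem moment_affine_dependence (d : ℕ) (hd : 1 ≤ d) (t : Fin (d + 2) → ℝ)
    (ht : StrictMono t) (V lam : Fin (d + 2) → ℝ)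
    (hV : ∀ i, V i = ∏ ℓ ∈ Finset.univ.erase i, ∏ k ∈ (Finset.Iio ℓ).erase i, (t ℓ - t k))
    (hlam : ∀ i, lam i = (-1 : ℝ) ^ (i.val + 1) * V i) :
    (∀ i, 0 < V i) ∧
    (∀ i : Fin (d + 1), lam i.castSucc * lam i.succ < 0) ∧
    (∑ i, lam i = 0) ∧
    (∑ i, lam i • moment d (t i) = 0) ∧
    (∀ j : Fin (d + 1), ∑ i, lam i * t i ^ j.val = 0) := by
  have h_pos (i : Fin (d + 2)) : 0 < V i := by
    rw [hV]
    refine Finset.prod_pos fun ℓ _ => Finset.prod_pos fun k hk => sub_pos.mpr (ht ?_)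
    exact Finset.mem_Iio.mp (Finset.mem_of_mem_erase hk)
  have h_sum (j : Fin (d + 1)) : ∑ i, lam i * t i ^ j.val = 0 := by
    rw [← neg_eq_zero, ← sum_neg_one_pow_mul_pow_mul_det_vandermonde t j,
      ← Finset.sum_neg_distrib]
    refine Finset.sum_congr rfl fun i _ => ?_
    rw [hlam, hV, prod_erase_sub_eq_det_vandermonde]
    ring
  refine ⟨h_pos, fun i => ?_, by simpa using h_sum 0, ?_, h_sum⟩
  · have h_sign : lam i.castSucc * lam i.succ = -(V i.castSucc * V i.succ) := by
      have h_sq : ((-1 : ℝ) ^ i.val) ^ 2 = 1 := by rw [← pow_mul, mul_comm, pow_mul]; simp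
      rw [hlam, hlam, Fin.val_castSucc, Fin.val_succ]
      linear_combination (-V i.castSucc * V i.succ) * h_sq
    rw [h_sign]
    exact neg_neg_of_pos (mul_pos (h_pos _) (h_pos _))
  · ext k
    simpa [moment] using h_sum k.succ
end

section
/- Let d ≥ 1 be an integer and let t_1 < t_2 < … < t_{d+2} be real numbers. Then the convex hull of the points μ_d(t_i) with i odd and the convex hull of the points μ_d(t_i) with i even have a common point: conv{μ_d(t_i) : 1 ≤ i ≤ d+2, i odd} ∩ conv{μ_d(t_i) : 1 ≤ i ≤ d+2, i even} ≠ ∅. (This is the Radon partition of the circuit formed by d+2 points on the moment curve, underlying its two triangulations.) -/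
open Finset

/-- The product of the differences of one node of an increasing sequence to the other nodes has
the sign of `(-1)` to the number of larger nodes. -/
theorem StrictMono.prod_erase_sub_eq {n : ℕ} {t : Fin n → ℝ} (ht : StrictMono t) (i : Fin n) :
    ∏ j ∈ univ.erase i, (t i - t j) =
      (-1) ^ (n - 1 - i.val) * ∏ j ∈ univ.erase i, |t i - t j| := by
  have hfactor : ∀ j ∈ univ.erase i,
      t i - t j = (if i < j then -1 else 1) * |t i - t j| := by
    intro j _
    split_ifs with h
    · rw [abs_of_neg (sub_neg.2 (ht h))]
      ring
    · rw [abs_of_nonneg (sub_nonneg.2 (ht.monotone (not_lt.1 h))), one_mul]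
  have hfilter : (univ.erase i).filter (fun j => i < j) = Finset.Ioi i := by
    ext j
    simp only [mem_filter, mem_erase, mem_univ, and_true, Finset.mem_Ioi, and_iff_right_iff_imp]
    exact fun h => h.ne'
  rw [prod_congr rfl hfactor, prod_mul_distrib, prod_ite, prod_const, prod_const_one, mul_one,
    hfilter, Fin.card_Ioi]

/-- An affine dependence with alternating signs between the values of monomials of low degree. -/
theorem StrictMono.sum_alternating_pow_eq_zero {n : ℕ} {t : Fin n → ℝ} (ht : StrictMono t)
    {k : ℕ} (hk : k + 1 < n) :
    ∑ i : Fin n, (-1) ^ i.val * ((∏ j ∈ univ.erase i, |t i - t j|)⁻¹ * t i ^ k) = 0 := by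
  have hcoeff := Lagrange.coeff_eq_sum (s := (univ : Finset (Fin n))) (v := t)
    (ht.injective.injOn) (P := (Polynomial.X ^ k : Polynomial ℝ))
    (by rw [Polynomial.degree_X_pow, card_univ, Fintype.card_fin]; exact_mod_cast (by omega))
  rw [card_univ, Fintype.card_fin, Polynomial.coeff_X_pow, if_neg (by omega)] at hcoeff
  rw [← mul_zero ((-1 : ℝ) ^ (n - 1)), hcoeff, mul_sum]
  refine sum_congr rfl fun i _ => ?_
  have hsign : (-1 : ℝ) ^ (n - 1) = (-1) ^ i.val * (-1) ^ (n - 1 - i.val) := by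
    rw [← pow_add]
    congr 1
    omega
  have hsq : (-1 : ℝ) ^ (n - 1 - i.val) * (-1) ^ (n - 1 - i.val) = 1 := by
    rw [← mul_pow]
    norm_num
  rw [ht.prod_erase_sub_eq i, Polynomial.eval_pow, Polynomial.eval_X, div_eq_mul_inv, mul_inv,
    ← inv_pow, inv_neg_one, hsign]
  linear_combination
    -((-1) ^ i.val * ((∏ j ∈ univ.erase i, |t i - t j|)⁻¹ * t i ^ k)) * hsq

/-- A sum with alternating signs vanishes iff its even-indexed and odd-indexed parts agree. -/
theorem sum_even_eq_sum_odd_of_alternating {n : ℕ} {f : Fin n → ℝ}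
    (hf : ∑ i : Fin n, (-1) ^ i.val * f i = 0) :
    ∑ i with (i.val + 1) % 2 = 1, f i = ∑ i with (i.val + 1) % 2 = 0, f i := by
  rw [← sub_eq_zero, ← hf, sum_filter, sum_filter, ← sum_sub_distrib]
  refine sum_congr rfl fun i _ => ?_
  rcases Nat.even_or_odd i.val with h | h
  · have h' : (i.val + 1) % 2 = 1 := by grind
    simp [h.neg_one_pow, h']
  · have h' : (i.val + 1) % 2 = 0 := by grind
    simp [h.neg_one_pow, h']

/-- Radon partition of the circuit formed by `d+2` points on the moment curve:
the convex hull of the points with odd (`1`-based) index meets the convex hull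
of the points with even index. -/
theorem moment_radon_partition (d : ℕ) (hd : 1 ≤ d) (t : Fin (d + 2) → ℝ)
    (ht : StrictMono t) :
    (convexHull ℝ ((fun i => moment d (t i)) '' {i : Fin (d + 2) | (i.val + 1) % 2 = 1}) ∩
      convexHull ℝ ((fun i => moment d (t i)) '' {i : Fin (d + 2) | (i.val + 1) % 2 = 0})).Nonempty := by
  let w : Fin (d + 2) → ℝ := fun i => (∏ j ∈ univ.erase i, |t i - t j|)⁻¹
  have hpos : ∀ i, 0 < w i := fun i => inv_pos.2 <| prod_pos fun j hj =>
    abs_pos.2 <| sub_ne_zero.2 fun h => (mem_erase.1 hj).1 (ht.injective h).symm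
  have hpow : ∀ k ≤ d, ∑ i with (i.val + 1) % 2 = 1, w i * t i ^ k =
      ∑ i with (i.val + 1) % 2 = 0, w i * t i ^ k := fun k hk =>
    sum_even_eq_sum_odd_of_alternating (ht.sum_alternating_pow_eq_zero (by omega))
  have hsum : ∑ i with (i.val + 1) % 2 = 1, w i = ∑ i with (i.val + 1) % 2 = 0, w i := by
    simpa using hpow 0 d.zero_le
  have hsum_pos : 0 < ∑ i with (i.val + 1) % 2 = 1, w i :=
    sum_pos (fun i _ => hpos i) ⟨0, by simp⟩
  have hmem : ∀ r : ℕ, 0 < ∑ i : Fin (d + 2) with (i.val + 1) % 2 = r, w i →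
      (univ.filter fun i : Fin (d + 2) => (i.val + 1) % 2 = r).centerMass w
        (fun i => moment d (t i)) ∈
      convexHull ℝ ((fun i => moment d (t i)) '' {i : Fin (d + 2) | (i.val + 1) % 2 = r}) :=
    fun r hr => centerMass_mem_convexHull _ (fun i _ => (hpos i).le) hr
      fun i hi => ⟨i, (mem_filter.1 hi).2, rfl⟩
  refine ⟨_, hmem 1 hsum_pos, ?_⟩
  convert hmem 0 (hsum ▸ hsum_pos) using 1
  rw [centerMass, centerMass, hsum]
  congr 1
  ext k
  simpa only [Finset.sum_apply, Pi.smul_apply, smul_eq_mul, moment] using hpow (k.val + 1) k.isLt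
end

section
/- Let d ≥ 1 be an integer and let t_1 < t_2 < … < t_{d+2} be real numbers. Then the simplices of the lower triangulation of C(d+2, d) cover the polytope: ⋃_{i ≡ d (mod 2), 1 ≤ i ≤ d+2} conv{μ_d(t_j) : j ≠ i} = conv{μ_d(t_1), …, μ_d(t_{d+2})}. -/
open Finset

/-- Given an affine dependence `c` with a positive coefficient, every point of the convex hull of a
finite family lies in the convex hull of the family with some point of positive coefficient
removed. -/
theorem exists_mem_convexHull_image_ne_of_affine_dependence {ι E : Type*} [Fintype ι]
    [AddCommGroup E] [Module ℝ E] {p : ι → E} {c : ι → ℝ} (hc : ∑ i, c i = 0)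
    (hcp : ∑ i, c i • p i = 0) (hpos : ∃ i, 0 < c i) {x : E}
    (hx : x ∈ convexHull ℝ (Set.range p)) :
    ∃ i, 0 < c i ∧ x ∈ convexHull ℝ (p '' {j | j ≠ i}) := by
  classical
  obtain ⟨w, hw0, hw1, rfl⟩ : ∃ w : ι → ℝ, (∀ i, 0 ≤ w i) ∧ ∑ i, w i = 1 ∧
      ∑ i, w i • p i = x := by
    rw [convexHull_range_eq_exists_affineCombination] at hx
    obtain ⟨s, w, hw0, hw1, rfl⟩ := hx
    refine ⟨fun i => if i ∈ s then w i else 0, fun i => ?_, by simpa using hw1, ?_⟩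
    · dsimp only
      split_ifs with h
      exacts [hw0 i h, le_rfl]
    · simp [s.affineCombination_eq_linear_combination p w hw1]
  obtain ⟨i₀, hi₀⟩ := hpos
  obtain ⟨i, hi, hmin⟩ := exists_min_image {i | 0 < c i} (fun i => w i / c i)
    ⟨i₀, by simpa using hi₀⟩
  simp only [mem_filter, mem_univ, true_and] at hi hmin
  refine ⟨i, hi, ?_⟩
  set l := w i / c i with hl
  have hl0 : 0 ≤ l := div_nonneg (hw0 i) hi.le
  have hvi : w i - l * c i = 0 := by rw [hl, div_mul_cancel₀ _ hi.ne', sub_self]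
  have hsum : ∑ j, w j • p j = ∑ j ∈ univ.erase i, (w j - l * c j) • p j := by
    rw [sum_erase _ (by rw [hvi, zero_smul])]
    simp [sub_smul, mul_smul, ← smul_sum, hcp]
  rw [hsum]
  refine (convex_convexHull ℝ _).sum_mem (fun j _ => ?_) ?_ fun j hj =>
    subset_convexHull ℝ _ ⟨j, by simpa using hj, rfl⟩
  · rcases lt_or_ge 0 (c j) with h | h
    · have := (le_div_iff₀ h).1 (hmin j h)
      linarith
    · have := mul_nonpos_of_nonneg_of_nonpos hl0 h
      linarith [hw0 j]
  · rw [sum_erase (f := fun j => w j - l * c j) _ hvi, sum_sub_distrib, ← mul_sum, hc, hw1]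
    simp

/-- For an increasing family of nodes, the product of the differences of `t i` with the other nodes
has sign `(-1) ^ #{j | i < j}`. -/
theorem StrictMono.neg_one_pow_mul_prod_erase_sub_pos {ι R : Type*} [Fintype ι] [LinearOrder ι]
    [LocallyFiniteOrderTop ι] [CommRing R] [LinearOrder R] [IsStrictOrderedRing R]
    {t : ι → R} (ht : StrictMono t) (i : ι) :
    0 < (-1) ^ #(Ioi i) * ∏ j ∈ univ.erase i, (t i - t j) := by
  have hsplit : ({j ∈ univ.erase i | i < j} : Finset ι) = Ioi i := by
    ext j
    simp only [mem_filter, mem_erase, mem_univ, and_true, mem_Ioi]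
    exact ⟨And.right, fun h => ⟨h.ne', h⟩⟩
  rw [← prod_filter_mul_prod_filter_not _ (fun j => i < j), hsplit, ← mul_assoc, ← prod_const,
    ← prod_mul_distrib]
  refine mul_pos (prod_pos fun j hj => ?_) (prod_pos fun j hj => ?_)
  · have := ht (mem_Ioi.1 hj)
    linarith
  · simp only [mem_filter, mem_erase, mem_univ, and_true, not_lt] at hj
    exact sub_pos.2 (ht (lt_of_le_of_ne hj.2 hj.1))

/-- The divided difference of order `#s - 1` annihilates the powers of smaller exponent. -/
theorem sum_pow_div_prod_erase_sub_eq_zero {ι F : Type*} [Field F] [DecidableEq ι]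
    {s : Finset ι} {v : ι → F} (hv : Set.InjOn v s) {k : ℕ} (hk : k + 1 < #s) :
    ∑ i ∈ s, v i ^ k / ∏ j ∈ s.erase i, (v i - v j) = 0 := by
  have h := Lagrange.coeff_eq_sum hv (P := (Polynomial.X ^ k : Polynomial F))
    (by rw [Polynomial.degree_X_pow]; exact_mod_cast (by lia : k < #s))
  rw [Polynomial.coeff_X_pow, if_neg (by lia)] at h
  simpa using h.symm

/-- The simplices of the lower triangulation of the cyclic polytope
`C(d+2, d)` — the simplices `conv{μ_d(t_j) : j ≠ i}` for the (`1`-based)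
indices `i ≡ d (mod 2)` — cover the whole polytope. -/
theorem lower_triangulation_covers (d : ℕ) (hd : 1 ≤ d)
    (t : Fin (d + 2) → ℝ) (ht : StrictMono t) :
    (⋃ i ∈ {i : Fin (d + 2) | (i.val + 1) % 2 = d % 2},
        convexHull ℝ ((fun j => moment d (t j)) '' {j : Fin (d + 2) | j ≠ i})) =
      convexHull ℝ (Set.range fun j => moment d (t j)) := by
  refine Set.Subset.antisymm
    (Set.iUnion₂_subset fun i _ => convexHull_mono (Set.image_subset_range _ _)) fun x hx => ?_
  have hsum (k : ℕ) (hk : k ≤ d) :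
      ∑ i, t i ^ k / ∏ j ∈ univ.erase i, (t i - t j) = 0 :=
    sum_pow_div_prod_erase_sub_eq_zero ht.injective.injOn (by rw [card_univ, Fintype.card_fin]; lia)
  have hpos (i : Fin (d + 2)) :
      0 < (∏ j ∈ univ.erase i, (t i - t j))⁻¹ ↔ (i.val + 1) % 2 = d % 2 := by
    have h := ht.neg_one_pow_mul_prod_erase_sub_pos i
    rw [Fin.card_Ioi] at h
    have hi := i.isLt
    rw [inv_pos]
    rcases Nat.even_or_odd (d + 2 - 1 - i) with he | ho
    · rw [he.neg_one_pow, one_mul] at h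
      exact iff_of_true h (by grind)
    · rw [ho.neg_one_pow] at h
      exact iff_of_false (by linarith) (by grind)
  obtain ⟨i, hi, hxi⟩ := exists_mem_convexHull_image_ne_of_affine_dependence
    (c := fun i => (∏ j ∈ univ.erase i, (t i - t j))⁻¹) (by simpa using hsum 0 (Nat.zero_le d))
    (by
      ext k
      simpa [moment, div_eq_inv_mul] using hsum (k + 1) k.isLt)
    ⟨⟨d - 1, by lia⟩, (hpos _).2 (by simp only; lia)⟩ hx
  exact Set.mem_iUnion₂.2 ⟨i, (hpos i).1 hi, hxi⟩
end

section
/- Let d ≥ 1 be an integer and let t_1 < t_2 < … < t_{d+2} be real numbers. Then the simplices of the upper triangulation of C(d+2, d) cover the polytope: ⋃_{i ≢ d (mod 2), 1 ≤ i ≤ d+2} conv{μ_d(t_j) : j ≠ i} = conv{μ_d(t_1), …, μ_d(t_{d+2})}. -/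
open Finset

/-- The convex hull of a finite family consists of its convex combinations. -/
theorem exists_weights_of_mem_convexHull_range {ι E : Type*} [Fintype ι] [AddCommGroup E]
    [Module ℝ E] {v : ι → E} {x : E} (hx : x ∈ convexHull ℝ (Set.range v)) :
    ∃ w : ι → ℝ, (∀ i, 0 ≤ w i) ∧ ∑ i, w i = 1 ∧ ∑ i, w i • v i = x := by
  classical
  have hv : Set.range v =
      Fintype.linearCombination ℝ v '' Set.range fun i : ι => Pi.single i (1 : ℝ) := by
    rw [← Set.range_comp]
    congr 1
    ext i
    simp [Fintype.linearCombination_apply_single]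
  rw [hv, ← LinearMap.image_convexHull, convexHull_rangle_single_eq_stdSimplex] at hx
  obtain ⟨w, ⟨hw₀, hw₁⟩, rfl⟩ := hx
  exact ⟨w, hw₀, hw₁, by simp [Fintype.linearCombination_apply]⟩

/-- Given an affine dependence `c` with a negative coefficient, each point of the convex hull lies
in the convex hull of the family with some point of negative coefficient deleted. -/
theorem exists_neg_mem_convexHull_image_ne {ι E : Type*} [Fintype ι] [AddCommGroup E]
    [Module ℝ E] {v : ι → E} {c : ι → ℝ} (hc₀ : ∑ i, c i = 0) (hcv : ∑ i, c i • v i = 0)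
    (hneg : ∃ i, c i < 0) {x : E} (hx : x ∈ convexHull ℝ (Set.range v)) :
    ∃ i, c i < 0 ∧ x ∈ convexHull ℝ (v '' {j | j ≠ i}) := by
  classical
  obtain ⟨w, hw₀, hw₁, rfl⟩ := exists_weights_of_mem_convexHull_range hx
  obtain ⟨i, hi, hmin⟩ := exists_min_image (univ.filter fun i => c i < 0) (fun i => w i / -c i)
    (by simpa [Finset.Nonempty] using hneg)
  simp only [mem_filter, mem_univ, true_and] at hi hmin
  refine ⟨i, hi, ?_⟩
  set s := w i / -c i with hs
  have hs₀ : 0 ≤ s := div_nonneg (hw₀ i) (by linarith)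
  have hsi : w i + s * c i = 0 := by
    rw [hs]
    field_simp [hi.ne]
    ring
  have hnonneg (j : ι) : 0 ≤ w j + s * c j := by
    rcases lt_or_ge (c j) 0 with hj | hj
    · have h := (le_div_iff₀ (by linarith : 0 < -c j)).1 (hmin j hj)
      linarith
    · have h₁ := hw₀ j
      have h₂ := mul_nonneg hs₀ hj
      linarith
  have hsum : ∑ j ∈ univ.erase i, (w j + s * c j) = 1 := by
    rw [sum_erase (f := fun j => w j + s * c j) _ hsi, sum_add_distrib, ← mul_sum, hc₀, hw₁]
    simp
  have hx : ∑ j ∈ univ.erase i, (w j + s * c j) • v j = ∑ j, w j • v j := by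
    rw [sum_erase _ (by rw [hsi, zero_smul])]
    simp only [add_smul, mul_smul, sum_add_distrib, ← smul_sum, hcv, smul_zero, add_zero]
  rw [← hx]
  refine (convex_convexHull ℝ _).sum_mem (fun j _ => hnonneg j) hsum fun j hj => ?_
  exact subset_convexHull ℝ _ ⟨j, (mem_erase.1 hj).1, rfl⟩

/-- Lower powers are annihilated by the divided difference at the nodes `t`. -/
theorem sum_inv_prod_sub_mul_pow_eq_zero {ι F : Type*} [Fintype ι] [DecidableEq ι] [Field F]
    {t : ι → F} (ht : Function.Injective t) {k : ℕ} (hk : k + 1 < Fintype.card ι) :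
    ∑ i, (∏ j ∈ univ.erase i, (t i - t j))⁻¹ * t i ^ k = 0 := by
  have h := Lagrange.coeff_eq_sum (s := univ) (v := t) ht.injOn
    (P := (Polynomial.X ^ k : Polynomial F)) (by
      rw [Polynomial.degree_X_pow, card_univ]
      exact_mod_cast (by omega : k < Fintype.card ι))
  rw [Polynomial.coeff_X_pow, if_neg (by rw [card_univ]; omega)] at h
  rw [h]
  refine sum_congr rfl fun i _ => ?_
  rw [Polynomial.eval_pow, Polynomial.eval_X, div_eq_inv_mul]

/-- For increasing nodes, the sign of `∏ j ≠ i, (t i - t j)` is determined by the number of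
indices after `i`. -/
theorem neg_one_pow_mul_prod_sub_pos {n : ℕ} {t : Fin n → ℝ} (ht : StrictMono t) (i : Fin n) :
    0 < (-1) ^ (n - 1 - i.val) * ∏ j ∈ univ.erase i, (t i - t j) := by
  have hunion : univ.erase i = Iio i ∪ Ioi i := by
    ext j
    simp [lt_or_lt_iff_ne]
  have hdisj : Disjoint (Iio i) (Ioi i) :=
    disjoint_left.2 fun j h₁ h₂ => lt_asymm (mem_Iio.1 h₁) (mem_Ioi.1 h₂)
  rw [hunion, prod_union hdisj, mul_left_comm, ← Fin.card_Ioi, ← prod_const, ← prod_mul_distrib]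
  refine mul_pos (prod_pos fun j hj => sub_pos.2 (ht (mem_Iio.1 hj))) (prod_pos fun j hj => ?_)
  linarith [ht (mem_Ioi.1 hj)]

theorem inv_prod_sub_neg_iff {n : ℕ} {t : Fin n → ℝ} (ht : StrictMono t) (i : Fin n) :
    (∏ j ∈ univ.erase i, (t i - t j))⁻¹ < 0 ↔ Odd (n - 1 - i.val) := by
  have h := neg_one_pow_mul_prod_sub_pos ht i
  rw [inv_lt_zero]
  rcases Nat.even_or_odd (n - 1 - i.val) with hp | hp
  · rw [hp.neg_one_pow, one_mul] at h
    exact iff_of_false h.not_gt (Nat.not_odd_iff_even.2 hp)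
  · rw [hp.neg_one_pow, neg_one_mul, neg_pos] at h
    exact iff_of_true h hp

/-- The simplices of the upper triangulation of the cyclic polytope
`C(d+2, d)` — the simplices `conv{μ_d(t_j) : j ≠ i}` for the (`1`-based)
indices `i ≢ d (mod 2)` — cover the whole polytope. -/
theorem upper_triangulation_covers (d : ℕ) (hd : 1 ≤ d)
    (t : Fin (d + 2) → ℝ) (ht : StrictMono t) :
    (⋃ i ∈ {i : Fin (d + 2) | (i.val + 1) % 2 ≠ d % 2},
        convexHull ℝ ((fun j => moment d (t j)) '' {j : Fin (d + 2) | j ≠ i})) =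
      convexHull ℝ (Set.range fun j => moment d (t j)) := by
  refine Set.Subset.antisymm
    (Set.iUnion₂_subset fun i _ => convexHull_mono (Set.image_subset_range _ _)) fun x hx => ?_
  have hzero {k : ℕ} (hk : k ≤ d) :
      ∑ i, (∏ j ∈ univ.erase i, (t i - t j))⁻¹ * t i ^ k = 0 :=
    sum_inv_prod_sub_mul_pow_eq_zero ht.injective (by rw [Fintype.card_fin]; omega)
  obtain ⟨i, hi, hxi⟩ := exists_neg_mem_convexHull_image_ne
    (c := fun i => (∏ j ∈ univ.erase i, (t i - t j))⁻¹)
    (by simpa using hzero (Nat.zero_le d))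
    (by
      ext l
      simpa [moment] using hzero (k := l.val + 1) (by omega))
    ⟨⟨d, by omega⟩, (inv_prod_sub_neg_iff ht _).2 (by simp)⟩ hx
  rw [inv_prod_sub_neg_iff ht, Nat.odd_iff] at hi
  refine Set.mem_iUnion₂.2 ⟨i, ?_, hxi⟩
  change (i.val + 1) % 2 ≠ d % 2
  omega
end

section
/- Let d ≥ 1 be an integer and let t_1 < t_2 < … < t_{d+2} be real numbers. If i ≠ i' are two indices in {1, …, d+2} with i ≡ i' (mod 2), then the topological interiors (in ℝ^d) of the two d-simplices conv{μ_d(t_j) : j ≠ i} and conv{μ_d(t_j) : j ≠ i'} are disjoint. In particular, the simplices within the lower triangulation of C(d+2, d) have pairwise disjoint interiors, and likewise for the upper triangulation. -/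
open Finset

open Polynomial in
/-- The monic polynomial whose roots are the `t j` with `j ∉ {i, i'}`. -/
noncomputable def nodalErase {n : ℕ} (t : Fin n → ℝ) (i i' : Fin n) : ℝ[X] :=
  ∏ j ∈ (univ.erase i).erase i', (X - C (t j))

lemma nodalErase_comm {n : ℕ} (t : Fin n → ℝ) (i i' : Fin n) :
    nodalErase t i i' = nodalErase t i' i := by
  rw [nodalErase, nodalErase, erase_right_comm]

lemma nodalErase_monic {n : ℕ} (t : Fin n → ℝ) (i i' : Fin n) : (nodalErase t i i').Monic :=
  Polynomial.monic_prod_X_sub_C _ _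

lemma natDegree_nodalErase {d : ℕ} (t : Fin (d + 2) → ℝ) {i i' : Fin (d + 2)} (hne : i ≠ i') :
    (nodalErase t i i').natDegree = d := by
  rw [nodalErase, Polynomial.natDegree_finsetProd_X_sub_C_eq_card, card_erase_of_mem,
    card_erase_of_mem]
  · simp
  · simp
  · simp [hne.symm]

lemma eval_nodalErase {n : ℕ} (t : Fin n → ℝ) (i i' : Fin n) (s : ℝ) :
    (nodalErase t i i').eval s = ∏ j ∈ (univ.erase i).erase i', (s - t j) := by
  simp [nodalErase, Polynomial.eval_prod]

lemma eval_nodalErase_eq_zero {n : ℕ} (t : Fin n → ℝ) {i i' j : Fin n} (hi : j ≠ i)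
    (hi' : j ≠ i') : (nodalErase t i i').eval (t j) = 0 := by
  rw [eval_nodalErase]
  exact prod_eq_zero (i := j) (by simp [hi, hi']) (sub_self _)

/-- An odd number of the nodes lies strictly between `t i` and `t i'`. -/
lemma eval_nodalErase_mul_eval_neg_of_lt {n : ℕ} {t : Fin n → ℝ} (ht : StrictMono t)
    {i i' : Fin n} (hlt : i < i') (hpar : i.val % 2 = i'.val % 2) :
    (nodalErase t i i').eval (t i) * (nodalErase t i i').eval (t i') < 0 := by
  have key : ∀ j ∈ (univ.erase i).erase i', (t i - t j) * (t i' - t j) =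
      (if j ∈ Ioo i i' then -1 else 1) * |(t i - t j) * (t i' - t j)| := by
    intro j hj
    simp only [mem_erase, mem_univ, and_true] at hj
    split_ifs with h
    · rw [mem_Ioo] at h
      rw [abs_of_neg (mul_neg_of_neg_of_pos (sub_neg.2 (ht h.1)) (sub_pos.2 (ht h.2)))]
      ring
    · rw [one_mul, abs_of_nonneg]
      rcases lt_or_gt_of_ne hj.2 with h1 | h1
      · exact (mul_pos (sub_pos.2 (ht h1)) (sub_pos.2 (ht (h1.trans hlt)))).le
      · have h2 : i' < j := lt_of_le_of_ne (not_lt.1 fun h2 => h (mem_Ioo.2 ⟨h1, h2⟩)) hj.1.symm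
        exact (mul_pos_of_neg_of_neg (sub_neg.2 (ht h1)) (sub_neg.2 (ht h2))).le
  have hsub : ((univ.erase i).erase i').filter (· ∈ Ioo i i') = Ioo i i' := by
    ext j
    simp only [mem_filter, mem_erase, mem_univ, and_true, mem_Ioo, and_iff_right_iff_imp]
    exact fun h => ⟨h.2.ne, h.1.ne'⟩
  have hodd : Odd (Ioo i i').card := by
    rw [Fin.card_Ioo, Nat.odd_iff]
    have : i.val < i'.val := hlt
    omega
  rw [eval_nodalErase, eval_nodalErase, ← prod_mul_distrib, prod_congr rfl key, prod_mul_distrib,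
    ← prod_filter, hsub, prod_const, hodd.neg_one_pow, neg_one_mul, neg_lt_zero]
  refine prod_pos fun j hj => abs_pos.2 ?_
  simp only [mem_erase, mem_univ, and_true] at hj
  exact mul_ne_zero (sub_ne_zero.2 (ht.injective.ne hj.2.symm))
    (sub_ne_zero.2 (ht.injective.ne hj.1.symm))

lemma eval_nodalErase_mul_eval_neg {n : ℕ} {t : Fin n → ℝ} (ht : StrictMono t)
    {i i' : Fin n} (hne : i ≠ i') (hpar : i.val % 2 = i'.val % 2) :
    (nodalErase t i i').eval (t i) * (nodalErase t i i').eval (t i') < 0 := by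
  rcases lt_or_gt_of_ne hne with h | h
  · exact eval_nodalErase_mul_eval_neg_of_lt ht h hpar
  · rw [nodalErase_comm, mul_comm]
    exact eval_nodalErase_mul_eval_neg_of_lt ht h hpar.symm

/-- Sets on opposite sides of a hyperplane have disjoint interiors. -/
lemma interior_inter_interior_eq_empty_of_separated {E : Type*} [AddCommGroup E] [Module ℝ E]
    [TopologicalSpace E] [ContinuousAdd E] [ContinuousSMul ℝ E] {A B : Set E} (l : E →ₗ[ℝ] ℝ)
    (hl : l ≠ 0) (c : ℝ) (hA : ∀ x ∈ A, l x ≤ c) (hB : ∀ x ∈ B, c ≤ l x) :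
    interior A ∩ interior B = ∅ := by
  obtain ⟨e, he⟩ : ∃ e, l e ≠ 0 := by
    contrapose! hl
    exact LinearMap.ext hl
  rw [← interior_inter, Set.eq_empty_iff_forall_notMem]
  intro x hx
  have hcont : Filter.Tendsto (fun r : ℝ => x + r • e) (nhds 0) (nhds x) := by
    have : Continuous fun r : ℝ => x + r • e := by fun_prop
    simpa using this.tendsto 0
  have hev : ∀ᶠ r : ℝ in nhds 0, l (x + r • e) = c :=
    (hcont.eventually (mem_interior_iff_mem_nhds.1 hx)).mono
      fun r hr => le_antisymm (hA _ hr.1) (hB _ hr.2)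
  have hx0 : l x = c := by simpa using hev.self_of_nhds
  obtain ⟨r, hr, hr0⟩ :=
    ((hev.filter_mono nhdsWithin_le_nhds).and (self_mem_nhdsWithin (s := {0}ᶜ))).exists
  simp only [map_add, map_smul, smul_eq_mul, hx0, add_eq_left, mul_eq_zero] at hr
  exact hr.elim hr0 he

/-- The linear functional on `ℝ^d` whose coefficients are those of `p` in degrees `1, …, d`. -/
noncomputable def coeffFunctional (d : ℕ) (p : Polynomial ℝ) : (Fin d → ℝ) →ₗ[ℝ] ℝ :=
  ∑ k : Fin d, p.coeff (k.val + 1) • LinearMap.proj k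

lemma coeffFunctional_moment {d : ℕ} {p : Polynomial ℝ} (hp : p.natDegree ≤ d) (s : ℝ) :
    coeffFunctional d p (moment d s) = p.eval s - p.coeff 0 := by
  rw [Polynomial.eval_eq_sum_range' (Nat.lt_succ_of_le hp), sum_range_succ',
    ← Fin.sum_univ_eq_sum_range fun k => p.coeff (k + 1) * s ^ (k + 1)]
  simp [coeffFunctional, moment]

lemma coeffFunctional_ne_zero {d : ℕ} (hd : 1 ≤ d) {p : Polynomial ℝ} (hp : p.Monic)
    (hdeg : p.natDegree = d) : coeffFunctional d p ≠ 0 := by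
  intro h
  have h1 := LinearMap.congr_fun h (Pi.single ⟨d - 1, by omega⟩ 1)
  have h2 : p.coeff (d - 1 + 1) = 1 := by rw [Nat.sub_add_cancel hd, ← hdeg]; exact hp
  simp [coeffFunctional, Pi.single_apply, h2] at h1

lemma simplices_interior_disjoint_of_eval_pos_of_eval_neg {d : ℕ} (hd : 1 ≤ d)
    (t : Fin (d + 2) → ℝ) {i i' : Fin (d + 2)} (hne : i ≠ i')
    (hi : 0 < (nodalErase t i i').eval (t i)) (hi' : (nodalErase t i i').eval (t i') < 0) :
    interior (convexHull ℝ ((fun j => moment d (t j)) '' {j : Fin (d + 2) | j ≠ i})) ∩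
      interior (convexHull ℝ ((fun j => moment d (t j)) '' {j : Fin (d + 2) | j ≠ i'})) = ∅ := by
  set p := nodalErase t i i' with hp
  have hdeg : p.natDegree = d := natDegree_nodalErase t hne
  refine interior_inter_interior_eq_empty_of_separated (coeffFunctional d p)
    (coeffFunctional_ne_zero hd (nodalErase_monic t i i') hdeg) (-p.coeff 0) ?_ ?_
  · refine convexHull_min ?_ (convex_halfSpace_le (coeffFunctional d p).isLinear _)
    rintro _ ⟨j, hj, rfl⟩
    change coeffFunctional d p (moment d (t j)) ≤ _
    rw [coeffFunctional_moment hdeg.le]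
    have : p.eval (t j) ≤ 0 := by
      rcases eq_or_ne j i' with rfl | h
      · exact hi'.le
      · exact (eval_nodalErase_eq_zero t hj h).le
    linarith
  · refine convexHull_min ?_ (convex_halfSpace_ge (coeffFunctional d p).isLinear _)
    rintro _ ⟨j, hj, rfl⟩
    change _ ≤ coeffFunctional d p (moment d (t j))
    rw [coeffFunctional_moment hdeg.le]
    have : 0 ≤ p.eval (t j) := by
      rcases eq_or_ne j i with rfl | h
      · exact hi.le
      · exact (eval_nodalErase_eq_zero t h hj).ge
    linarith

/-- Two distinct `d`-simplices of the same triangulation (lower or upper) of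
`C(d+2, d)` have disjoint interiors: if `i ≠ i'` have the same parity
(`1`-based), then the interiors of `conv{μ_d(t_j) : j ≠ i}` and
`conv{μ_d(t_j) : j ≠ i'}` are disjoint. -/
theorem simplices_interior_disjoint (d : ℕ) (hd : 1 ≤ d)
    (t : Fin (d + 2) → ℝ) (ht : StrictMono t) (i i' : Fin (d + 2))
    (hne : i ≠ i') (hpar : (i.val + 1) % 2 = (i'.val + 1) % 2) :
    interior (convexHull ℝ ((fun j => moment d (t j)) '' {j : Fin (d + 2) | j ≠ i})) ∩
      interior (convexHull ℝ ((fun j => moment d (t j)) '' {j : Fin (d + 2) | j ≠ i'})) = ∅ := by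
  rcases mul_neg_iff.1 (eval_nodalErase_mul_eval_neg ht hne (by omega)) with ⟨h, h'⟩ | ⟨h, h'⟩
  · exact simplices_interior_disjoint_of_eval_pos_of_eval_neg hd t hne h h'
  · rw [nodalErase_comm] at h h'
    rw [Set.inter_comm]
    exact simplices_interior_disjoint_of_eval_pos_of_eval_neg hd t hne.symm h' h
end

section
/- Let d ≥ 1 be an integer and let t_1 < t_2 < … < t_{d+2} be real numbers. Then the normalized volume of the cyclic polytope C(d+2, d) equals the sum of the normalized volumes of the simplices of its lower triangulation: d! · vol(conv{μ_d(t_1), …, μ_d(t_{d+2})}) = ∑_{i ≡ d (mod 2), 1 ≤ i ≤ d+2} V_i, where V_i := ∏_{1 ≤ k < ℓ ≤ d+2, k ≠ i, ℓ ≠ i} (t_ℓ − t_k) and vol denotes d-dimensional Lebesgue measure. -/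
open Finset MeasureTheory

section Convexity

variable {ι E : Type*} [Fintype ι] [AddCommGroup E] [Module ℝ E]

theorem mem_convexHull_image_iff_exists_weights (p : ι → E) (s : Set ι) (x : E) :
    x ∈ convexHull ℝ (p '' s) ↔
      ∃ w : ι → ℝ, (∀ i, 0 ≤ w i) ∧ (∀ i ∉ s, w i = 0) ∧ ∑ i, w i = 1 ∧ ∑ i, w i • p i = x := by
  classical
  constructor
  · intro hx
    let K : Set (ι → ℝ) := {w | (∀ i, 0 ≤ w i) ∧ (∀ i ∉ s, w i = 0) ∧ ∑ i, w i = 1}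
    have hK : Convex ℝ K := by
      rintro u ⟨hu0, hus, hu1⟩ v ⟨hv0, hvs, hv1⟩ a b ha hb hab
      refine ⟨fun i => ?_, fun i hi => ?_, ?_⟩
      · exact add_nonneg (mul_nonneg ha (hu0 i)) (mul_nonneg hb (hv0 i))
      · simp [hus i hi, hvs i hi]
      · simp [Finset.sum_add_distrib, ← Finset.mul_sum, hu1, hv1, hab]
    have hsub : convexHull ℝ (p '' s) ⊆ Fintype.linearCombination ℝ p '' K := by
      refine convexHull_min ?_ (hK.linear_image _)
      rintro _ ⟨i, hi, rfl⟩
      refine ⟨Pi.single i 1, ⟨fun j => ?_, fun j hj => ?_, ?_⟩, ?_⟩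
      · exact (Pi.single_nonneg (α := fun _ : ι => ℝ) (i := i)).2 zero_le_one j
      · exact Pi.single_eq_of_ne (fun h : j = i => hj (h ▸ hi)) 1
      · simp
      · simp
    obtain ⟨w, ⟨h0, hs, h1⟩, rfl⟩ := hsub hx
    exact ⟨w, h0, hs, h1, (Fintype.linearCombination_apply ℝ p w).symm⟩
  · rintro ⟨w, h0, hs, h1, rfl⟩
    rw [← Finset.sum_subset (Finset.filter_subset (· ∈ s) _) fun i _ hi => by
      simp [hs i (by simpa using hi)]]
    refine (convex_convexHull ℝ _).sum_mem (fun i _ => h0 i) ?_ fun i hi => ?_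
    · rw [← h1]
      exact Finset.sum_subset (Finset.filter_subset _ _) fun i _ hi => hs i (by simpa using hi)
    · exact subset_convexHull ℝ _ ⟨i, by simpa using hi, rfl⟩

/-- Removing a suitable positively signed vertex of an affine dependence never leaves the
convex hull: the hull is the union of the corresponding subhulls. -/
theorem convexHull_range_eq_biUnion_of_affine_dependence (p : ι → E) (c : ι → ℝ)
    (hc0 : ∑ i, c i = 0) (hcp : ∑ i, c i • p i = 0) (hpos : ∃ i, 0 < c i) :
    convexHull ℝ (Set.range p) = ⋃ i ∈ Finset.univ.filter (fun i => 0 < c i),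
      convexHull ℝ (p '' {i}ᶜ) := by
  classical
  apply Set.Subset.antisymm
  · intro x hx
    rw [← Set.image_univ, mem_convexHull_image_iff_exists_weights] at hx
    obtain ⟨w, h0, -, h1, rfl⟩ := hx
    obtain ⟨i, hi, hmin⟩ := (Finset.univ.filter (fun i => 0 < c i)).exists_min_image
      (fun i => w i / c i) (by simpa [Finset.filter_nonempty_iff] using hpos)
    have hci : 0 < c i := by simpa using hi
    simp only [Set.mem_iUnion]
    refine ⟨i, hi, ?_⟩
    rw [mem_convexHull_image_iff_exists_weights]
    refine ⟨fun j => w j - w i / c i * c j, fun j => ?_, fun j hj => ?_, ?_, ?_⟩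
    · rcases lt_or_ge 0 (c j) with hj | hj
      · have := (le_div_iff₀ hj).1 (hmin j (by simpa using hj))
        linarith
      · have := mul_nonpos_of_nonneg_of_nonpos (div_nonneg (h0 i) hci.le) hj
        linarith [h0 j]
    · obtain rfl : j = i := by simpa using hj
      field_simp
      ring
    · simp [Finset.sum_sub_distrib, ← Finset.mul_sum, h1, hc0]
    · simp [sub_smul, mul_smul, Finset.sum_sub_distrib, ← Finset.smul_sum, hcp]
  · refine Set.iUnion₂_subset fun i _ => convexHull_mono (Set.image_subset_range _ _)

/-- If the affine dependence is unique up to scaling, two of the subhulls meet in a common face. -/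
theorem convexHull_image_compl_singleton_inter_subset (p : ι → E) (c : ι → ℝ)
    (huniq : ∀ b : ι → ℝ, ∑ i, b i = 0 → ∑ i, b i • p i = 0 → ∃ s : ℝ, ∀ i, b i = s * c i)
    {i j : ι} (hi : 0 < c i) (hj : 0 < c j) :
    convexHull ℝ (p '' {i}ᶜ) ∩ convexHull ℝ (p '' {j}ᶜ) ⊆ convexHull ℝ (p '' {i, j}ᶜ) := by
  rintro x ⟨hxi, hxj⟩
  rw [mem_convexHull_image_iff_exists_weights] at hxi hxj ⊢
  obtain ⟨u, hu0, hui, hu1, hux⟩ := hxi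
  obtain ⟨v, hv0, hvj, hv1, hvx⟩ := hxj
  obtain ⟨s, hs⟩ := huniq (fun k => u k - v k) (by simp [Finset.sum_sub_distrib, hu1, hv1])
    (by simp [sub_smul, Finset.sum_sub_distrib, hux, hvx])
  have hui' : u i = 0 := hui i (by simp)
  have hvj' : v j = 0 := hvj j (by simp)
  have h1 : s * c i ≤ 0 := by rw [← hs i, hui']; linarith [hv0 i]
  have h2 : 0 ≤ s * c j := by rw [← hs j, hvj']; linarith [hu0 j]
  have hs0 : s = 0 := by
    apply le_antisymm
    · exact nonpos_of_mul_nonpos_left h1 hi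
    · exact nonneg_of_mul_nonneg_left h2 hj
  refine ⟨u, hu0, fun k hk => ?_, hu1, hux⟩
  have hk' : k = i ∨ k = j := by simpa [or_iff_not_imp_left] using hk
  rcases hk' with rfl | rfl
  · exact hui'
  · have := hs k
    rw [hs0, hvj'] at this
    linarith

end Convexity

theorem volume_corner_simplex (n : ℕ) {c : ℝ} (hc : 0 ≤ c) :
    volume {x : Fin n → ℝ | (∀ i, 0 ≤ x i) ∧ ∑ i, x i ≤ c} =
      ENNReal.ofReal (c ^ n / n.factorial) := by
  induction n generalizing c with
  | zero =>
    have : {x : Fin 0 → ℝ | (∀ i, 0 ≤ x i) ∧ ∑ i, x i ≤ c} = Set.univ := by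
      ext x; simp [hc]
    rw [this, volume_pi, Measure.pi_of_empty _ 0]
    simp
  | succ n ih =>
    set S : Set (ℝ × (Fin n → ℝ)) :=
      {q | (0 ≤ q.1 ∧ ∀ i, 0 ≤ q.2 i) ∧ q.1 + ∑ i, q.2 i ≤ c} with hS
    have hSm : MeasurableSet S := by
      have hsum : IsClosed {q : ℝ × (Fin n → ℝ) | q.1 + ∑ i, q.2 i ≤ c} :=
        isClosed_le (by fun_prop) continuous_const
      apply IsClosed.measurableSet
      refine IsClosed.inter (IsClosed.inter ?_ ?_) hsum
      · exact isClosed_le continuous_const continuous_fst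
      · exact isClosed_Ici.preimage continuous_snd
    have hpre : {x : Fin (n + 1) → ℝ | (∀ i, 0 ≤ x i) ∧ ∑ i, x i ≤ c} =
        MeasurableEquiv.piFinSuccAbove (fun _ => ℝ) 0 ⁻¹' S := by
      ext x
      simp [hS, Fin.forall_fin_succ, Fin.sum_univ_succ, MeasurableEquiv.piFinSuccAbove,
        Fin.insertNthEquiv, Fin.tail]
    rw [hpre, (volume_preserving_piFinSuccAbove (fun _ => ℝ) 0).measure_preimage
      hSm.nullMeasurableSet]
    change (volume : Measure (ℝ × (Fin n → ℝ))) S = _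
    rw [Measure.volume_eq_prod, Measure.prod_apply hSm]
    have hslice : ∀ s : ℝ, volume (Prod.mk s ⁻¹' S) =
        (Set.Icc 0 c).indicator (fun s => ENNReal.ofReal ((c - s) ^ n / n.factorial)) s := by
      intro s
      by_cases hs : s ∈ Set.Icc 0 c
      · rw [Set.indicator_of_mem hs, ← ih (sub_nonneg.2 hs.2)]
        congr 1
        ext y
        simp [hS, hs.1, le_sub_iff_add_le']
      · rw [Set.indicator_of_notMem hs]
        refine (congrArg _ ?_).trans measure_empty
        rw [Set.eq_empty_iff_forall_notMem]
        rintro y ⟨⟨h0, hy⟩, h1⟩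
        exact hs ⟨h0, by linarith [Finset.sum_nonneg fun i (_ : i ∈ Finset.univ) => hy i]⟩
    simp_rw [hslice]
    rw [lintegral_indicator measurableSet_Icc, ← ofReal_integral_eq_lintegral_ofReal]
    · congr 1
      rw [integral_Icc_eq_integral_Ioc, ← intervalIntegral.integral_of_le hc,
        intervalIntegral.integral_div,
        intervalIntegral.integral_comp_sub_left (fun x => x ^ n), integral_pow, Nat.factorial_succ]
      push_cast
      field_simp
      simp
    · exact (Continuous.integrableOn_Icc (by fun_prop))
    · filter_upwards [ae_restrict_mem measurableSet_Icc] with s hs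
      have := sub_nonneg.2 hs.2
      positivity

theorem volume_convexHull_range_simplex (n : ℕ) (p : Fin (n + 1) → Fin n → ℝ) :
    volume (convexHull ℝ (Set.range p)) =
      ENNReal.ofReal (|(Matrix.of fun i j : Fin n => p i.succ j - p 0 j).det| / n.factorial) := by
  set M : Matrix (Fin n) (Fin n) ℝ := Matrix.of fun i j => p i.succ j - p 0 j with hM
  have hML : ∀ y : Fin n → ℝ, Matrix.toLin' M.transpose y = ∑ i, y i • (p i.succ - p 0) := by
    intro y
    ext j
    simp [hM, Matrix.mulVec, dotProduct, mul_comm]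
  have himg : convexHull ℝ (Set.range p) = (fun x => p 0 + x) '' (Matrix.toLin' M.transpose ''
      {x : Fin n → ℝ | (∀ i, 0 ≤ x i) ∧ ∑ i, x i ≤ 1}) := by
    ext x
    rw [← Set.image_univ, mem_convexHull_image_iff_exists_weights, Set.image_image]
    constructor
    · rintro ⟨w, h0, -, h1, rfl⟩
      rw [Fin.sum_univ_succ] at h1
      refine ⟨fun i => w i.succ, ⟨fun i => h0 _, by linarith [h0 0]⟩, ?_⟩
      simp only [hML, Fin.sum_univ_succ, smul_sub, Finset.sum_sub_distrib, ← Finset.sum_smul]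
      rw [eq_sub_of_add_eq h1, sub_smul, one_smul]
      abel
    · rintro ⟨y, ⟨h0, h1⟩, rfl⟩
      refine ⟨Fin.cons (1 - ∑ i, y i) y, Fin.cases (by simpa using h1) (by simpa using h0),
        by simp, by simp [Fin.sum_univ_succ], ?_⟩
      simp only [hML, Fin.sum_univ_succ, smul_sub, Finset.sum_sub_distrib, ← Finset.sum_smul,
        Fin.cons_zero, Fin.cons_succ, sub_smul, one_smul]
      abel
  rw [himg, Set.image_add_left, measure_preimage_add, Measure.addHaar_image_linearMap,
    volume_corner_simplex n zero_le_one, LinearMap.det_toLin', Matrix.det_transpose,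
    ← ENNReal.ofReal_mul (abs_nonneg _)]
  simp [div_eq_mul_inv]

theorem volume_convexHull_image_finset_eq_zero {ι : Type*} {d : ℕ} (p : ι → Fin d → ℝ)
    (s : Finset ι) (hs : s.card = d) (hd : 1 ≤ d) : volume (convexHull ℝ (p '' s)) = 0 := by
  classical
  obtain ⟨n, rfl⟩ := Nat.exists_eq_add_of_le' hd
  refine measure_mono_null (convexHull_subset_affineSpan (p '' s))
    (Measure.addHaar_affineSubspace _ _ fun htop => ?_)
  have h := finrank_vectorSpan_image_finset_le ℝ p s hs
  rw [Finset.coe_image, ← direction_affineSpan, htop, AffineSubspace.direction_top,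
    finrank_top] at h
  simp at h

theorem det_moment_sub_eq_det_vandermonde (d : ℕ) (s : Fin (d + 1) → ℝ) :
    (Matrix.of fun i j : Fin d => moment d (s i.succ) j - moment d (s 0) j).det =
      (Matrix.vandermonde s).det := by
  let B : Matrix (Fin (d + 1)) (Fin (d + 1)) ℝ :=
    Matrix.of fun i j => s i ^ (j : ℕ) - if i = 0 then 0 else s 0 ^ (j : ℕ)
  have h : (Matrix.vandermonde s).det = B.det := by
    refine Matrix.det_eq_of_forall_row_eq_smul_add_const (fun i => if i = 0 then 0 else 1) 0
      (by simp) fun i j => ?_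
    by_cases hi : i = 0 <;> simp [B, hi, Matrix.vandermonde_apply]
  rw [h, Matrix.det_succ_column_zero, Fin.sum_univ_succ]
  have h0 : ∀ i : Fin d, B i.succ 0 = 0 := fun i => by simp [B]
  have h1 : B 0 0 = 1 := by simp [B]
  simp only [h0, h1, mul_zero, zero_mul, Finset.sum_const_zero, add_zero, Fin.val_zero, pow_zero,
    one_mul]
  congr 1

theorem det_vandermonde_pos {n : ℕ} {s : Fin n → ℝ} (hs : StrictMono s) :
    0 < (Matrix.vandermonde s).det := by
  rw [Matrix.det_vandermonde]
  exact Finset.prod_pos fun i _ => Finset.prod_pos fun j hj =>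
    sub_pos.2 (hs (Finset.mem_Ioi.1 hj))

theorem det_vandermonde_succAbove_pos {n : ℕ} {t : Fin (n + 1) → ℝ} (ht : StrictMono t)
    (i : Fin (n + 1)) : 0 < (Matrix.vandermonde fun k => t (i.succAbove k)).det :=
  det_vandermonde_pos (ht.comp (Fin.strictMono_succAbove i))

theorem det_vandermonde_succAbove {n : ℕ} (t : Fin (n + 1) → ℝ) (i : Fin (n + 1)) :
    (Matrix.vandermonde fun k => t (i.succAbove k)).det =
      ∏ ℓ ∈ Finset.univ.erase i, ∏ k ∈ (Finset.Iio ℓ).erase i, (t ℓ - t k) := by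
  have hu : Finset.univ.erase i = Finset.univ.map i.succAboveEmb := by
    ext k
    simp [← Fin.exists_succAbove_eq_iff]
  have hI : ∀ a : Fin n, (Finset.Iio (i.succAbove a)).erase i =
      (Finset.Iio a).map i.succAboveEmb := by
    intro a
    ext k
    simp only [Finset.mem_erase, Finset.mem_Iio, Finset.mem_map, Fin.succAboveEmb_apply,
      ← Fin.exists_succAbove_eq_iff]
    constructor
    · rintro ⟨⟨b, rfl⟩, hb⟩
      exact ⟨b, Fin.succAbove_lt_succAbove_iff.1 hb, rfl⟩
    · rintro ⟨b, hb, rfl⟩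
      exact ⟨⟨b, rfl⟩, Fin.succAbove_lt_succAbove_iff.2 hb⟩
  rw [Matrix.det_vandermonde, hu, Finset.prod_map]
  simp only [Fin.succAboveEmb_apply, hI, Finset.prod_map]
  exact Finset.prod_comm' (by simp)

theorem volume_convexHull_moment_image_compl_singleton (d : ℕ) {t : Fin (d + 2) → ℝ}
    (ht : StrictMono t) (i : Fin (d + 2)) :
    volume (convexHull ℝ ((fun j => moment d (t j)) '' {i}ᶜ)) =
      ENNReal.ofReal ((Matrix.vandermonde fun k => t (i.succAbove k)).det / d.factorial) := by
  rw [← Fin.range_succAbove, ← Set.range_comp]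
  refine (volume_convexHull_range_simplex d _).trans ?_
  simp only [Function.comp_apply]
  rw [det_moment_sub_eq_det_vandermonde d fun k => t (i.succAbove k),
    abs_of_pos (det_vandermonde_succAbove_pos ht i)]

/-- The coefficients of the affine dependence of `n + 1` points on the moment curve
of degree `n - 1`, as signed Vandermonde minors. -/
noncomputable def momentCircuit {n : ℕ} (t : Fin (n + 1) → ℝ) (i : Fin (n + 1)) : ℝ :=
  (-1) ^ (i.val + n) * (Matrix.vandermonde fun k => t (i.succAbove k)).det

theorem sum_momentCircuit_mul_pow {n : ℕ} (t : Fin (n + 1) → ℝ) {m : ℕ} (hm : m < n) :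
    ∑ i, momentCircuit t i * t i ^ m = 0 := by
  let A : Matrix (Fin (n + 1)) (Fin (n + 1)) ℝ :=
    Matrix.of fun i j => if j = Fin.last n then t i ^ m else t i ^ (j : ℕ)
  have hA : A.det = 0 := by
    refine Matrix.det_zero_of_column_eq (i := Fin.last n) (j := Fin.castSucc ⟨m, hm⟩)
      (Fin.castSucc_lt_last _).ne' fun k => ?_
    simp [A]
  rw [← hA, Matrix.det_succ_column A (Fin.last n)]
  refine Finset.sum_congr rfl fun i _ => ?_
  have : A.submatrix i.succAbove (Fin.last n).succAbove =
      Matrix.vandermonde fun k => t (i.succAbove k) := by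
    ext a b
    simp [A, (Fin.castSucc_lt_last _).ne, Matrix.vandermonde_apply]
  rw [this]
  simp only [momentCircuit, A, Matrix.of_apply, if_true, Fin.val_last]
  ring

theorem momentCircuit_pos_iff {n : ℕ} {t : Fin (n + 1) → ℝ} (ht : StrictMono t)
    (i : Fin (n + 1)) : 0 < momentCircuit t i ↔ i.val % 2 = n % 2 := by
  have h := det_vandermonde_succAbove_pos ht i
  rw [momentCircuit, mul_pos_iff_of_pos_right h]
  rcases Nat.even_or_odd (i.val + n) with he | ho
  · simp only [he.neg_one_pow, zero_lt_one, true_iff]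
    rw [Nat.even_iff] at he
    omega
  · simp only [ho.neg_one_pow, Left.neg_pos_iff]
    rw [Nat.odd_iff] at ho
    exact iff_of_false (by norm_num) (by omega)

theorem momentCircuit_ne_zero {n : ℕ} {t : Fin (n + 1) → ℝ} (ht : StrictMono t)
    (i : Fin (n + 1)) : momentCircuit t i ≠ 0 :=
  mul_ne_zero (pow_ne_zero _ (by norm_num))
    (det_vandermonde_succAbove_pos ht i).ne'

theorem exists_eq_mul_momentCircuit {n : ℕ} {t : Fin (n + 1) → ℝ} (ht : StrictMono t)
    (b : Fin (n + 1) → ℝ) (hb : ∀ m < n, ∑ i, b i * t i ^ m = 0) :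
    ∃ s : ℝ, ∀ i, b i = s * momentCircuit t i := by
  refine ⟨b 0 / momentCircuit t 0, ?_⟩
  set s := b 0 / momentCircuit t 0 with hs
  have h0 : b 0 = s * momentCircuit t 0 := (div_mul_cancel₀ _ (momentCircuit_ne_zero ht 0)).symm
  have hz : (fun k : Fin n => b k.succ - s * momentCircuit t k.succ) = 0 := by
    refine Matrix.eq_zero_of_forall_pow_sum_mul_pow_eq_zero (f := fun k => t k.succ)
      (ht.comp (Fin.strictMono_succ)).injective fun m => ?_
    have h1 := hb m m.2
    have h2 := sum_momentCircuit_mul_pow t m.2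
    rw [Fin.sum_univ_succ] at h1 h2
    simp only [sub_mul, Finset.sum_sub_distrib, mul_assoc, ← Finset.mul_sum]
    rw [eq_neg_of_add_eq_zero_right h1, eq_neg_of_add_eq_zero_right h2, h0]
    ring
  exact Fin.cases h0 fun k => sub_eq_zero.1 (congrFun hz k)

theorem sum_smul_moment_apply {ι : Type*} [Fintype ι] (d : ℕ) (b t : ι → ℝ) (m : Fin d) :
    (∑ i, b i • moment d (t i)) m = ∑ i, b i * t i ^ (m.val + 1) := by
  simp [moment]

/-- The normalized volume (Lebesgue volume times `d!`) of the cyclic polytope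
`C(d+2, d)` is the sum of the Vandermonde products `V_i` over the (`1`-based)
indices `i ≡ d (mod 2)`, i.e. over the simplices of the lower triangulation. -/
theorem normalized_volume_cyclic_polytope (d : ℕ) (hd : 1 ≤ d)
    (t : Fin (d + 2) → ℝ) (ht : StrictMono t) :
    (d.factorial : ENNReal) * volume (convexHull ℝ (Set.range fun j => moment d (t j))) =
      ENNReal.ofReal (∑ i ∈ Finset.univ.filter
          (fun i : Fin (d + 2) => (i.val + 1) % 2 = d % 2),
        ∏ ℓ ∈ Finset.univ.erase i, ∏ k ∈ (Finset.Iio ℓ).erase i, (t ℓ - t k)) := by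
  have hpos : ∀ i : Fin (d + 2), 0 < momentCircuit t i ↔ (i.val + 1) % 2 = d % 2 := by
    intro i
    rw [momentCircuit_pos_iff ht]
    omega
  have huniq : ∀ b : Fin (d + 2) → ℝ, ∑ i, b i = 0 → ∑ i, b i • moment d (t i) = 0 →
      ∃ s : ℝ, ∀ i, b i = s * momentCircuit t i := by
    intro b hb0 hb
    refine exists_eq_mul_momentCircuit ht b fun m hm => ?_
    cases m with
    | zero => simpa using hb0
    | succ m =>
      rw [← sum_smul_moment_apply d b t ⟨m, by omega⟩, hb, Pi.zero_apply]
  rw [convexHull_range_eq_biUnion_of_affine_dependence _ (momentCircuit t)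
    (by simpa using sum_momentCircuit_mul_pow t (m := 0) (Nat.succ_pos d))
    (by
      ext m
      rw [sum_smul_moment_apply, sum_momentCircuit_mul_pow t (by omega), Pi.zero_apply])
    ⟨Fin.last _, (momentCircuit_pos_iff ht _).2 (by simp)⟩,
    measure_biUnion_finset₀]
  · simp only [hpos, volume_convexHull_moment_image_compl_singleton d ht,
      ← det_vandermonde_succAbove]
    have hnn : ∀ i : Fin (d + 2), 0 ≤ (Matrix.vandermonde fun k => t (i.succAbove k)).det :=
      fun i => (det_vandermonde_succAbove_pos ht i).le
    rw [← ENNReal.ofReal_sum_of_nonneg fun i _ => div_nonneg (hnn i) (Nat.cast_nonneg _),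
      ← ENNReal.ofReal_natCast, ← ENNReal.ofReal_mul (Nat.cast_nonneg _), ← Finset.sum_div,
      mul_div_cancel₀ _ (Nat.cast_ne_zero.2 d.factorial_ne_zero)]
  · intro i hi j hj hij
    refine measure_mono_null (convexHull_image_compl_singleton_inter_subset _ _ huniq
      (by simpa using hi) (by simpa using hj)) ?_
    have := volume_convexHull_image_finset_eq_zero (fun j => moment d (t j)) ({i, j}ᶜ)
      (by rw [Finset.card_compl, Finset.card_pair hij]; simp) hd
    rwa [Finset.coe_compl, Finset.coe_pair] at this
  · intro i _
    exact ((Set.toFinite _).isCompact_convexHull (𝕜 := ℝ)).measurableSet.nullMeasurableSet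
end
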